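/- Let M ∈ ℝ^{m×n} have rows M_1, …, M_m, let ε > 0, and let f(x) = −∑_{i=1}^m √(⟨M_i, x⟩² + ε). Fix x ∈ ℝ^n with ‖x‖₂ = 1 and ξ ∈ ℝ^n with ‖ξ‖₂ = 1 and ⟨x, ξ⟩ = 0, and define g : ℝ → ℝ by g(τ) = f((x + τξ)/‖x + τξ‖₂). Then for all t with 0 ≤ t ≤ 1, |g′(t) − g′(0)| ≤ ((2/√ε)·∑_{i=1}^m ‖M_i‖₂² + 2·∑_{i=1}^m ‖M_i‖₂)·t; i.e., the pullback f̂_x(ξ) = f(R_x(ξ)) of f through the retraction R_x(ξ) = (x + ξ)/‖x + ξ‖₂ is radially Lipschitz continuously differentiable. -/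

import Mathlib

open Finset Real RealInnerProductSpace

theorem norm_add_smul_of_orthonormal {E : Type*} [NormedAddCommGroup E] [InnerProductSpace ℝ E]
    {x ξ : E} (hx : ‖x‖ = 1) (hξ : ‖ξ‖ = 1) (hperp : ⟪x, ξ⟫ = 0) (p q : ℝ) :
    ‖p • x + q • ξ‖ = √(p ^ 2 + q ^ 2) := by
  rw [eq_comm, Real.sqrt_eq_iff_mul_self_eq (by positivity) (norm_nonneg _), ← sq,
    norm_add_sq_real, norm_smul, norm_smul, inner_smul_left, inner_smul_right, hperp, hx, hξ]
  simp

/-- The Cauchy–Schwarz inequality against a vector in the span of an orthonormal pair. -/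
theorem abs_inner_combination_le {E : Type*} [NormedAddCommGroup E] [InnerProductSpace ℝ E]
    {x ξ : E} (hx : ‖x‖ = 1) (hξ : ‖ξ‖ = 1) (hperp : ⟪x, ξ⟫ = 0) (v : E) (p q : ℝ) :
    |p * ⟪v, x⟫ + q * ⟪v, ξ⟫| ≤ ‖v‖ * √(p ^ 2 + q ^ 2) := by
  rw [← norm_add_smul_of_orthonormal hx hξ hperp, ← inner_smul_right, ← inner_smul_right,
    ← inner_add_right]
  exact abs_real_inner_le_norm _ _

theorem sqrt_sq_add_pos {ε : ℝ} (hε : 0 < ε) (u : ℝ) : 0 < √(u ^ 2 + ε) :=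
  Real.sqrt_pos.2 (by positivity)

theorem abs_le_sqrt_sq_add {ε : ℝ} (hε : 0 < ε) (u : ℝ) : |u| ≤ √(u ^ 2 + ε) :=
  Real.abs_le_sqrt (by linarith)

theorem abs_div_sqrt_sq_add_le_one {ε : ℝ} (hε : 0 < ε) (u : ℝ) :
    |u / √(u ^ 2 + ε)| ≤ 1 := by
  rw [abs_div, abs_of_pos (sqrt_sq_add_pos hε u), div_le_one (sqrt_sq_add_pos hε u)]
  exact abs_le_sqrt_sq_add hε u

theorem abs_sqrt_sq_add_sub_le {ε : ℝ} (hε : 0 < ε) (u v : ℝ) :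
    |√(u ^ 2 + ε) - √(v ^ 2 + ε)| ≤ |u - v| := by
  have hp := sqrt_sq_add_pos hε u
  have hq := sqrt_sq_add_pos hε v
  have hprod : |√(u ^ 2 + ε) - √(v ^ 2 + ε)| * (√(u ^ 2 + ε) + √(v ^ 2 + ε)) =
      |u - v| * |u + v| := by
    rw [← abs_of_pos (add_pos hp hq), ← abs_mul, ← abs_mul]
    congr 1
    have h1 := Real.sq_sqrt (show 0 ≤ u ^ 2 + ε by positivity)
    have h2 := Real.sq_sqrt (show 0 ≤ v ^ 2 + ε by positivity)
    linear_combination h1 - h2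
  have hsum : |u + v| ≤ √(u ^ 2 + ε) + √(v ^ 2 + ε) :=
    (abs_add_le u v).trans (add_le_add (abs_le_sqrt_sq_add hε u) (abs_le_sqrt_sq_add hε v))
  refine le_of_mul_le_mul_right ?_ (add_pos hp hq)
  rw [hprod]
  gcongr

theorem abs_div_sqrt_sq_add_sub_le {ε : ℝ} (hε : 0 < ε) (u v : ℝ) :
    |u / √(u ^ 2 + ε) - v / √(v ^ 2 + ε)| ≤ 2 / √ε * |u - v| := by
  have hp := sqrt_sq_add_pos hε u
  have hq := sqrt_sq_add_pos hε v
  have hs : √ε ≤ √(u ^ 2 + ε) := Real.sqrt_le_sqrt (by nlinarith)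
  have hs0 : 0 < √ε := Real.sqrt_pos.2 hε
  have key : u / √(u ^ 2 + ε) - v / √(v ^ 2 + ε) =
      ((u - v) + v / √(v ^ 2 + ε) * (√(v ^ 2 + ε) - √(u ^ 2 + ε))) / √(u ^ 2 + ε) := by
    field_simp
    ring
  have hnum : |(u - v) + v / √(v ^ 2 + ε) * (√(v ^ 2 + ε) - √(u ^ 2 + ε))| ≤ 2 * |u - v| := by
    refine (abs_add_le _ _).trans ?_
    rw [abs_mul, abs_sub_comm (√(v ^ 2 + ε))]
    have := mul_le_mul (abs_div_sqrt_sq_add_le_one hε v) (abs_sqrt_sq_add_sub_le hε u v)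
      (abs_nonneg _) zero_le_one
    linarith
  rw [key, abs_div, abs_of_pos hp, div_mul_eq_mul_div 2]
  exact div_le_div₀ (by positivity) hnum hs0 hs

theorem hasDerivAt_div_sqrt_one_add_sq (a b t : ℝ) :
    HasDerivAt (fun τ : ℝ => (a + τ * b) / √(1 + τ ^ 2))
      ((b - t * a) / ((1 + t ^ 2) * √(1 + t ^ 2))) t := by
  have h0 : 0 < 1 + t ^ 2 := by positivity
  have hr := Real.sqrt_pos.2 h0
  have hnum : HasDerivAt (fun τ : ℝ => a + τ * b) b t := by
    simpa using ((hasDerivAt_id t).mul_const b).const_add a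
  have hsq : HasDerivAt (fun τ : ℝ => 1 + τ ^ 2) (2 * t) t := by
    simpa using (hasDerivAt_pow 2 t).const_add 1
  refine (hnum.div (hsq.sqrt h0.ne') hr.ne').congr_deriv ?_
  have h2 := Real.sq_sqrt h0.le
  rw [h2]
  field_simp
  rw [h2]
  ring

theorem hasDerivAt_sqrt_sq_add {ε : ℝ} (hε : 0 < ε) {u : ℝ → ℝ} {u' t : ℝ}
    (hu : HasDerivAt u u' t) :
    HasDerivAt (fun τ => √(u τ ^ 2 + ε)) (u t / √(u t ^ 2 + ε) * u') t := by
  have hp := sqrt_sq_add_pos hε (u t)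
  refine (((hu.pow 2).add_const ε).sqrt (show u t ^ 2 + ε ≠ 0 by positivity)).congr_deriv ?_
  simp only [Nat.cast_ofNat, Pi.pow_apply]
  field_simp
  ring

theorem one_sub_sq_div_two_le_inv_sqrt (t : ℝ) : 1 - t ^ 2 / 2 ≤ (√(1 + t ^ 2))⁻¹ := by
  have h0 : 0 < 1 + t ^ 2 := by positivity
  have hr := Real.sqrt_pos.2 h0
  have h2 := Real.sq_sqrt h0.le
  have h1 : 1 ≤ √(1 + t ^ 2) := Real.one_le_sqrt.2 (by nlinarith)
  rw [← one_div, le_div_iff₀ hr]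
  nlinarith [mul_nonneg (sub_nonneg.2 h1) (sub_nonneg.2 h1)]

theorem one_sub_le_inv_mul_sqrt {t : ℝ} (ht0 : 0 ≤ t) (ht1 : t ≤ 1) :
    1 - t ≤ ((1 + t ^ 2) * √(1 + t ^ 2))⁻¹ := by
  have h0 : 0 < 1 + t ^ 2 := by positivity
  have hr := Real.sqrt_pos.2 h0
  have hle : √(1 + t ^ 2) ≤ 1 + t ^ 2 := by
    rw [Real.sqrt_le_left h0.le]
    nlinarith [sq_nonneg t]
  have hpoly : (1 - t) * ((1 + t ^ 2) * (1 + t ^ 2)) ≤ 1 := by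
    have : 0 ≤ t * ((1 - t) ^ 2 + t ^ 2 * (1 - t) + t ^ 4) :=
      mul_nonneg ht0 (add_nonneg (add_nonneg (sq_nonneg _)
        (mul_nonneg (sq_nonneg _) (sub_nonneg.2 ht1))) (by positivity))
    linear_combination this
  rw [← one_div, le_div_iff₀ (mul_pos h0 hr)]
  refine le_trans ?_ hpoly
  have := sub_nonneg.2 ht1
  gcongr

/-- The radial Lipschitz estimate for one summand of the smoothed objective. -/
theorem abs_radial_deriv_sub_le {E : Type*} [NormedAddCommGroup E] [InnerProductSpace ℝ E]
    {x ξ : E} (hx : ‖x‖ = 1) (hξ : ‖ξ‖ = 1) (hperp : ⟪x, ξ⟫ = 0) (v : E) {ε t : ℝ}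
    (hε : 0 < ε) (ht0 : 0 ≤ t) (ht1 : t ≤ 1) {u u' : ℝ}
    (hu : u = (⟪v, x⟫ + t * ⟪v, ξ⟫) / √(1 + t ^ 2))
    (hu' : u' = (⟪v, ξ⟫ - t * ⟪v, x⟫) / ((1 + t ^ 2) * √(1 + t ^ 2))) :
    |u / √(u ^ 2 + ε) * u' - ⟪v, x⟫ / √(⟪v, x⟫ ^ 2 + ε) * ⟪v, ξ⟫| ≤
      (2 / √ε * ‖v‖ ^ 2 + 2 * ‖v‖) * t := by
  have h0 : 0 < 1 + t ^ 2 := by positivity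
  have hr := Real.sqrt_pos.2 h0
  have hr2 := Real.sq_sqrt h0.le
  have hr1 : 1 ≤ √(1 + t ^ 2) := Real.one_le_sqrt.2 (by nlinarith)
  have hd1 : 1 ≤ (1 + t ^ 2) * √(1 + t ^ 2) :=
    one_le_mul_of_one_le_of_one_le (by nlinarith) hr1
  have hdpos : 0 < (1 + t ^ 2) * √(1 + t ^ 2) := mul_pos h0 hr
  have hu'_le : |u'| ≤ ‖v‖ := by
    have h := abs_inner_combination_le hx hξ hperp v (-t) 1
    rw [show -t * ⟪v, x⟫ + 1 * ⟪v, ξ⟫ = ⟪v, ξ⟫ - t * ⟪v, x⟫ by ring,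
      show (-t) ^ 2 + 1 ^ 2 = 1 + t ^ 2 by ring] at h
    rw [hu', abs_div, abs_of_pos hdpos, div_le_iff₀ hdpos]
    refine h.trans ?_
    gcongr
    nlinarith [mul_nonneg (sq_nonneg t) hr.le]
  have hu_sub : |u - ⟪v, x⟫| ≤ ‖v‖ * t := by
    have h := abs_inner_combination_le hx hξ hperp v ((√(1 + t ^ 2))⁻¹ - 1)
      (t * (√(1 + t ^ 2))⁻¹)
    rw [show ((√(1 + t ^ 2))⁻¹ - 1) * ⟪v, x⟫ + t * (√(1 + t ^ 2))⁻¹ * ⟪v, ξ⟫ = u - ⟪v, x⟫ by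
      rw [hu]; ring] at h
    refine h.trans (mul_le_mul_of_nonneg_left ?_ (norm_nonneg v))
    rw [Real.sqrt_le_left ht0]
    have hc : (1 + t ^ 2) * (√(1 + t ^ 2))⁻¹ ^ 2 = 1 := by
      rw [inv_pow, hr2, mul_inv_cancel₀ h0.ne']
    linear_combination 2 * one_sub_sq_div_two_le_inv_sqrt t + hc
  have hu'_sub : |u' - ⟪v, ξ⟫| ≤ 2 * ‖v‖ * t := by
    have hk := one_sub_le_inv_mul_sqrt ht0 ht1
    have hk1 := inv_le_one_of_one_le₀ hd1
    have hk0 := inv_pos.2 hdpos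
    set k := ((1 + t ^ 2) * √(1 + t ^ 2))⁻¹
    have hx' : |⟪v, x⟫| ≤ ‖v‖ := by simpa [hx] using abs_real_inner_le_norm v x
    have hξ' : |⟪v, ξ⟫| ≤ ‖v‖ := by simpa [hξ] using abs_real_inner_le_norm v ξ
    have e : u' - ⟪v, ξ⟫ = (k - 1) * ⟪v, ξ⟫ - t * k * ⟪v, x⟫ := by
      rw [hu', div_eq_mul_inv]; ring
    rw [e]
    refine (abs_sub _ _).trans ?_
    rw [abs_mul, abs_mul, abs_of_nonneg (mul_nonneg ht0 hk0.le), abs_of_nonpos (by linarith)]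
    have h1 : -(k - 1) * |⟪v, ξ⟫| ≤ t * ‖v‖ := by gcongr; linarith
    have h2 : t * k * |⟪v, x⟫| ≤ t * 1 * ‖v‖ := by gcongr
    linarith
  have split : u / √(u ^ 2 + ε) * u' - ⟪v, x⟫ / √(⟪v, x⟫ ^ 2 + ε) * ⟪v, ξ⟫ =
      (u / √(u ^ 2 + ε) - ⟪v, x⟫ / √(⟪v, x⟫ ^ 2 + ε)) * u' +
        ⟪v, x⟫ / √(⟪v, x⟫ ^ 2 + ε) * (u' - ⟪v, ξ⟫) := by ring
  rw [split]
  refine (abs_add_le _ _).trans ?_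
  rw [abs_mul, abs_mul]
  calc _ ≤ (2 / √ε * (‖v‖ * t)) * ‖v‖ + 1 * (2 * ‖v‖ * t) := by
        gcongr
        · exact (abs_div_sqrt_sq_add_sub_le hε _ _).trans (by gcongr)
        · exact abs_div_sqrt_sq_add_le_one hε _
    _ = _ := by ring

/-- For `f y = -∑ i, √(⟨M i, y⟩² + ε)`, a unit vector `x`, and a unit
tangent vector `ξ` (`⟨x,ξ⟩ = 0`), the pullback `g τ = f((x + τ•ξ)/‖x + τ•ξ‖)` of `f`
through the retraction satisfies, for all `0 ≤ t ≤ 1`,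
`|g'(t) - g'(0)| ≤ ((2/√ε)·∑ i, ‖M i‖² + 2·∑ i, ‖M i‖)·t`; that is, `f ∘ R_x` is
radially Lipschitz continuously differentiable. -/
theorem statement12 (m n : ℕ) (M : Fin m → EuclideanSpace ℝ (Fin n)) (ε : ℝ) (hε : 0 < ε)
    (x ξ : EuclideanSpace ℝ (Fin n)) (hx : ‖x‖ = 1) (hξ : ‖ξ‖ = 1) (hperp : ⟪x, ξ⟫ = 0)
    (g : ℝ → ℝ)
    (hg : ∀ τ : ℝ, g τ =
      -∑ i : Fin m, Real.sqrt (⟪M i, ‖x + τ • ξ‖⁻¹ • (x + τ • ξ)⟫ ^ 2 + ε)) :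
    ∀ t : ℝ, 0 ≤ t → t ≤ 1 →
      |deriv g t - deriv g 0| ≤
        ((2 / Real.sqrt ε) * (∑ i : Fin m, ‖M i‖ ^ 2) +
          2 * ∑ i : Fin m, ‖M i‖) * t := by
  intro t ht0 ht1
  have hfun : g = fun τ => -∑ i : Fin m,
      √(((⟪M i, x⟫ + τ * ⟪M i, ξ⟫) / √(1 + τ ^ 2)) ^ 2 + ε) := by
    funext τ
    have hnorm := norm_add_smul_of_orthonormal hx hξ hperp 1 τ
    rw [one_smul, one_pow] at hnorm
    simp only [hg, hnorm, inner_smul_right, inner_add_right, div_eq_inv_mul]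
  have hderiv := fun s : ℝ => (HasDerivAt.fun_sum (u := Finset.univ) fun i _ =>
    hasDerivAt_sqrt_sq_add hε (hasDerivAt_div_sqrt_one_add_sq ⟪M i, x⟫ ⟪M i, ξ⟫ s)).fun_neg.deriv
  rw [hfun, hderiv, hderiv, neg_sub_neg, abs_sub_comm, ← Finset.sum_sub_distrib,
    Finset.mul_sum, Finset.mul_sum, ← Finset.sum_add_distrib, Finset.sum_mul]
  refine (Finset.abs_sum_le_sum_abs _ _).trans (Finset.sum_le_sum fun i _ => ?_)
  simpa using abs_radial_deriv_sub_le hx hξ hperp (M i) hε ht0 ht1 rfl rfl
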